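/- A centrally essential ring R is a right uniserial, right Noetherian ring if and only if R is either a commutative discrete valuation domain or a (not necessarily commutative) uniserial Artinian ring. -/

import Mathlib

/-- A ring `A` is *centrally essential* if for every nonzero `a ∈ A` there exist
nonzero central elements `c, d ∈ A` with `a * c = d`. -/
def IsCentrallyEssential (A : Type*) [Ring A] : Prop :=
  ∀ a : A, a ≠ 0 → ∃ c d : A, c ∈ Set.center A ∧ d ∈ Set.center A ∧
    c ≠ 0 ∧ d ≠ 0 ∧ a * c = d

/-- A ring is *right uniserial* if its right ideals are totally ordered by inclusion. -/
def IsRightUniserial (A : Type*) [Ring A] : Prop :=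
  ∀ I J : Submodule Aᵐᵒᵖ A, I ≤ J ∨ J ≤ I

/-- A ring is *uniserial* if its right ideals are totally ordered by inclusion and its
left ideals are totally ordered by inclusion. -/
def IsUniserialRing (A : Type*) [Ring A] : Prop :=
  IsRightUniserial A ∧ (∀ I J : Ideal A, I ≤ J ∨ J ≤ I)

/-- A ring is *Artinian* if it is both left and right Artinian. -/
def IsArtinianBothSides (A : Type*) [Ring A] : Prop :=
  IsArtinian A A ∧ IsArtinian Aᵐᵒᵖ A

/-- A ring is a *commutative discrete valuation domain* if it is commutative and a
local principal ideal domain that is not a field. -/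
def IsCommDVR (A : Type*) [Ring A] : Prop :=
  (∀ x y : A, x * y = y * x) ∧ (∀ x y : A, x * y = 0 → x = 0 ∨ y = 0) ∧
    IsLocalRing A ∧ (∀ I : Ideal A, I.IsPrincipal) ∧ ¬IsField A

/-- Every submodule is one of the members of a finite chain of cyclic submodules as soon as
every cyclic submodule is. -/
theorem Submodule.exists_eq_span_singleton_of_chain {S N : Type*} [Semiring S]
    [AddCommMonoid N] [Module S N] {f : ℕ → N} {n : ℕ}
    (hf : ∀ i j, i ≤ j → f j ∈ span S {f i})
    (h : ∀ x : N, ∃ i ≤ n, span S {x} = span S {f i}) (I : Submodule S N) :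
    ∃ i ≤ n, I = span S {f i} := by
  classical
  obtain ⟨k, hk, hk0⟩ := h 0
  have mem_iff {x : N} {i : ℕ} (hx : span S {x} = span S {f i}) (J : Submodule S N) :
      x ∈ J ↔ f i ∈ J := by
    rw [← span_singleton_le_iff_mem, hx, span_singleton_le_iff_mem]
  have hex : ∃ i, i ≤ n ∧ f i ∈ I := ⟨k, hk, (mem_iff hk0 I).1 I.zero_mem⟩
  refine ⟨Nat.find hex, (Nat.find_spec hex).1, le_antisymm (fun x hx => ?_)
    ((span_singleton_le_iff_mem _ _).2 (Nat.find_spec hex).2)⟩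
  obtain ⟨j, hj, hxj⟩ := h x
  exact (mem_iff hxj _).2 (hf _ _ (Nat.find_min' hex ⟨hj, (mem_iff hxj I).1 hx⟩))

theorem Submodule.total_and_isArtinian_of_chain {S N : Type*} [Ring S]
    [AddCommGroup N] [Module S N] {f : ℕ → N} {n : ℕ}
    (hf : ∀ i j, i ≤ j → f j ∈ span S {f i})
    (h : ∀ x : N, ∃ i ≤ n, span S {x} = span S {f i}) :
    (∀ I J : Submodule S N, I ≤ J ∨ J ≤ I) ∧ IsArtinian S N := by
  have key := exists_eq_span_singleton_of_chain hf h
  refine ⟨fun I J => ?_, ?_⟩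
  · obtain ⟨i, -, rfl⟩ := key I
    obtain ⟨j, -, rfl⟩ := key J
    simp only [span_singleton_le_iff_mem]
    exact (le_total j i).imp (hf j i) (hf i j)
  · have : Finite (Submodule S N) :=
      Set.finite_univ_iff.1 (((Set.finite_Iic n).image fun i => span S {f i}).subset
        fun I _ => (key I).imp fun i hi => ⟨hi.1, hi.2.symm⟩)
    exact inferInstanceAs (WellFoundedLT (Submodule S N))

theorem Submodule.exists_eq_span_singleton_of_total {S N : Type*} [Semiring S]
    [AddCommMonoid N] [Module S N] [IsNoetherian S N]
    (h : ∀ I J : Submodule S N, I ≤ J ∨ J ≤ I) (I : Submodule S N) :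
    ∃ a, I = span S {a} :=
  fg_induction (motive := fun I _ => ∃ a, I = span S {a}) (fun x => ⟨x, rfl⟩)
    (fun I J _ _ hI hJ => by
      rcases h I J with hIJ | hIJ
      · rwa [sup_eq_right.2 hIJ]
      · rwa [sup_eq_left.2 hIJ]) I (IsNoetherian.noetherian I)

/-- In a commutative ring presented as a `Ring`, ideals and right ideals coincide. -/
def idealOrderIsoRight {R : Type*} [Ring R] (h : ∀ x y : R, x * y = y * x) :
    Ideal R ≃o Submodule Rᵐᵒᵖ R where
  toFun I := { I.toAddSubmonoid with
    smul_mem' := fun c x hx => by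
      change x * c.unop ∈ I
      rw [h]
      exact I.mul_mem_left _ hx }
  invFun J := { J.toAddSubmonoid with
    smul_mem' := fun c x hx => by
      change c * x ∈ J
      rw [h]
      exact J.smul_mem (MulOpposite.op c) hx }
  left_inv _ := rfl
  right_inv _ := rfl
  map_rel_iff' := Iff.rfl

/-- The regular right module of a ring, as the regular left module of the opposite ring. -/
def mulOppositeRightLinearEquiv (R : Type*) [Ring R] : Rᵐᵒᵖ ≃ₗ[Rᵐᵒᵖ] R where
  __ := MulOpposite.opAddEquiv.symm
  map_smul' _ _ := rfl

theorem IsArtinian.isNoetherian_right {R : Type*} [Ring R] (h : IsArtinian Rᵐᵒᵖ R) :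
    IsNoetherian Rᵐᵒᵖ R := by
  have : IsArtinianRing Rᵐᵒᵖ := (mulOppositeRightLinearEquiv R).isArtinian_iff.2 h
  exact isNoetherian_of_linearEquiv (mulOppositeRightLinearEquiv R)

section CommDVR

variable {R : Type*} [Ring R]

theorem IsCommDVR.isRightUniserial_and_isNoetherian (h : IsCommDVR R) :
    IsRightUniserial R ∧ IsNoetherian Rᵐᵒᵖ R := by
  obtain ⟨hcomm, hdom, hlocal, hprin, -⟩ := h
  let e := idealOrderIsoRight hcomm
  let _ : CommRing R := { ‹Ring R› with mul_comm := hcomm }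
  have : IsLocalRing R := hlocal
  have : IsDomain R :=
    have : NoZeroDivisors R := ⟨fun {x y} => hdom x y⟩
    NoZeroDivisors.to_isDomain R
  have : IsPrincipalIdealRing R := ⟨hprin⟩
  have : ValuationRing R := inferInstance
  refine ⟨fun I J => ?_, ?_⟩
  · simpa using (ValuationRing.iff_ideal_total.1 ‹_›).total (e.symm I) (e.symm J)
  · rw [isNoetherian_iff']
    have : WellFoundedGT (Ideal R) := inferInstance
    exact e.symm.toOrderEmbedding.wellFoundedGT

end CommDVR

section Uniformizer

variable {R : Type*} [Ring R]

theorem mem_span_singleton_right {a x : R} : x ∈ Submodule.span Rᵐᵒᵖ {a} ↔ a ∣ x := by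
  rw [Submodule.mem_span_singleton]
  exact ⟨fun ⟨r, hr⟩ => ⟨r.unop, hr.symm⟩, fun ⟨r, hr⟩ => ⟨MulOpposite.op r, hr.symm⟩⟩

/-- The right ideal `π R` is the set of nonunits of the ring. -/
structure IsRightUniformizer (π : R) : Prop where
  isUnit_or_dvd : ∀ x, IsUnit x ∨ π ∣ x
  not_isUnit_mul : ∀ r, ¬ IsUnit (π * r)

theorem exists_isRightUniformizer [Nontrivial R] [IsNoetherian Rᵐᵒᵖ R]
    (h : IsRightUniserial R) : ∃ π : R, IsRightUniformizer π := by
  obtain ⟨M, hM, -⟩ := (eq_top_or_exists_le_coatom (⊥ : Submodule Rᵐᵒᵖ R)).resolve_left bot_ne_top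
  obtain ⟨π, rfl⟩ := Submodule.exists_eq_span_singleton_of_total h M
  have hone : ¬ π ∣ 1 := fun hd => hM.1 <| by
    rw [Submodule.eq_top_iff']
    exact fun x => mem_span_singleton_right.2 (hd.trans ⟨x, (one_mul x).symm⟩)
  have hinv (x : R) (hx : ¬ π ∣ x) : ∃ y, x * y = 1 := by
    have htop : Submodule.span Rᵐᵒᵖ {x} = ⊤ := by
      rcases h (Submodule.span Rᵐᵒᵖ {x}) (Submodule.span Rᵐᵒᵖ {π}) with hle | hle
      · exact absurd (mem_span_singleton_right.1 (hle (Submodule.mem_span_singleton_self x))) hx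
      · refine hM.2 _ (lt_of_le_of_ne hle fun heq => hx ?_)
        rw [← mem_span_singleton_right, heq]
        exact Submodule.mem_span_singleton_self x
    obtain ⟨y, hy⟩ := mem_span_singleton_right.1 (htop ▸ Submodule.mem_top : (1 : R) ∈ _)
    exact ⟨y, hy.symm⟩
  -- one-sided inverses are two-sided because idempotents are trivial
  have hded (x y : R) (hxy : x * y = 1) (hx : ¬ π ∣ x) : y * x = 1 := by
    by_cases he : π ∣ y * x
    · have hne : ¬ π ∣ 1 - y * x := fun hd => hone (by simpa using dvd_add hd he)
      obtain ⟨z, hz⟩ := hinv _ hne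
      have hx0 : x * (1 - y * x) = 0 := by
        rw [mul_sub, ← mul_assoc, hxy]; simp
      have : x = 0 := by
        calc x = x * ((1 - y * x) * z) := by rw [hz, mul_one]
          _ = 0 := by rw [← mul_assoc, hx0, zero_mul]
      exact absurd (this ▸ dvd_zero π) hx
    · obtain ⟨z, hz⟩ := hinv _ he
      have h0 : (1 - y * x) * (y * x) = 0 := by
        have : y * x * (y * x) = y * (x * y) * x := by noncomm_ring
        rw [sub_mul, this, hxy]; simp
      have : 1 - y * x = 0 := by
        calc 1 - y * x = (1 - y * x) * ((y * x) * z) := by rw [hz, mul_one]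
          _ = 0 := by rw [← mul_assoc, h0, zero_mul]
      exact (sub_eq_zero.1 this).symm
  refine ⟨π, fun x => or_iff_not_imp_right.2 fun hx => ?_, fun r hr => ?_⟩
  · obtain ⟨y, hy⟩ := hinv x hx
    exact ⟨⟨x, y, hy, hded x y hy hx⟩, rfl⟩
  · obtain ⟨y, hy⟩ := hr.exists_right_inv
    exact hone ⟨r * y, by rw [← mul_assoc, hy]⟩

namespace IsRightUniformizer

variable {π : R}

theorem not_isUnit (hπ : IsRightUniformizer π) : ¬ IsUnit π := by
  simpa using hπ.not_isUnit_mul 1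

theorem isUnit_one_sub_mul (hπ : IsRightUniformizer π) (r : R) : IsUnit (1 - π * r) :=
  (hπ.isUnit_or_dvd _).resolve_right fun ⟨s, hs⟩ => hπ.not_isUnit_mul (r + s) (by
    rw [mul_add, ← hs]; simp)

theorem dvd_mul_self (hπ : IsRightUniformizer π) (r : R) : π ∣ r * π := by
  refine (hπ.isUnit_or_dvd _).resolve_left fun hu => ?_
  obtain ⟨s, hs⟩ := hu.exists_left_inv
  rw [← mul_assoc] at hs
  rcases hπ.isUnit_or_dvd (s * r) with hy | ⟨z, hz⟩
  · obtain ⟨u, hu⟩ := hy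
    rw [← hu] at hs
    exact hπ.not_isUnit (Units.isUnit_units_mul u π |>.1 (hs ▸ isUnit_one))
  · exact hπ.not_isUnit_mul (z * π) (by rw [← mul_assoc, ← hz, hs]; exact isUnit_one)

theorem pow_dvd_mul_pow (hπ : IsRightUniformizer π) (r : R) (n : ℕ) : π ^ n ∣ r * π ^ n := by
  induction n generalizing r with
  | zero => simp
  | succ n ih =>
    obtain ⟨s, hs⟩ := hπ.dvd_mul_self r
    obtain ⟨t, ht⟩ := ih s
    exact ⟨t, by rw [pow_succ', ← mul_assoc, hs, mul_assoc, ht, mul_assoc]⟩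

theorem pow_dvd_or_exists_unit (hπ : IsRightUniformizer π) (x : R) (n : ℕ) :
    π ^ n ∣ x ∨ ∃ i < n, ∃ u : Rˣ, x = π ^ i * u := by
  induction n with
  | zero => simp
  | succ n ih =>
    rcases ih with ⟨y, rfl⟩ | ⟨i, hi, hu⟩
    · rcases hπ.isUnit_or_dvd y with ⟨u, rfl⟩ | ⟨z, rfl⟩
      · exact .inr ⟨n, n.lt_succ_self, u, rfl⟩
      · exact .inl ⟨z, by rw [pow_succ, mul_assoc]⟩
    · exact .inr ⟨i, by omega, hu⟩

theorem isLocalRing (hπ : IsRightUniformizer π) [Nontrivial R] : IsLocalRing R :=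
  IsLocalRing.of_isUnit_or_isUnit_one_sub_self fun a => by
    refine (hπ.isUnit_or_dvd a).imp id ?_
    rintro ⟨r, rfl⟩
    exact hπ.isUnit_one_sub_mul r

theorem eq_zero_of_mem_center (hπ : IsRightUniformizer π)
    [IsNoetherian Rᵐᵒᵖ R] {d : R} (hd : d ∈ Set.center R)
    (h : ∀ n, π ^ n ∣ d) : d = 0 := by
  let I : ℕ →o Submodule Rᵐᵒᵖ R :=
    { toFun := fun n =>
        { carrier := {x | d ∣ π ^ n * x}
          add_mem' := fun {x y} hx hy => by
            change d ∣ π ^ n * (x + y)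
            rw [mul_add]
            exact dvd_add hx hy
          zero_mem' := by simp
          smul_mem' := fun r x hx => by
            change d ∣ π ^ n * (x * r.unop)
            rw [← mul_assoc]
            exact hx.mul_right _ }
      monotone' := monotone_nat_of_le_succ fun n x (hx : d ∣ π ^ n * x) => by
        obtain ⟨r, hr⟩ := hx
        exact ⟨π * r, by rw [pow_succ', mul_assoc, hr, ← mul_assoc, ← mul_assoc, hd.comm π]⟩ }
  obtain ⟨n, hn⟩ := monotone_stabilizes_iff_noetherian.2 ‹_› I
  obtain ⟨x, hx⟩ := h (n + 1)
  have hmem : x ∈ I n := by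
    rw [hn (n + 1) n.le_succ]
    exact ⟨1, by rw [← hx, mul_one]⟩
  obtain ⟨r, hr⟩ : d ∣ π ^ n * x := hmem
  refine (hπ.isUnit_one_sub_mul r).mul_right_eq_zero.1 ?_
  rw [sub_mul, one_mul, mul_assoc, ← hd.comm r, ← hr, ← mul_assoc, ← pow_succ', ← hx, sub_self]

theorem exists_eq_pow_mul_unit (hπ : IsRightUniformizer π)
    [IsNoetherian Rᵐᵒᵖ R] (hCE : IsCentrallyEssential R) {x : R}
    (hx : x ≠ 0) : ∃ (i : ℕ) (u : Rˣ), x = π ^ i * u := by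
  by_contra! hne
  obtain ⟨c, d, -, hd, -, hd0, rfl⟩ := hCE x hx
  refine hd0 (hπ.eq_zero_of_mem_center hd fun n => Dvd.dvd.mul_right ?_ c)
  exact (hπ.pow_dvd_or_exists_unit x n).resolve_right fun ⟨i, _, u, hu⟩ => hne i u hu

theorem isRightUniserial_and_isArtinian (hπ : IsRightUniformizer π) {n : ℕ} (hn : π ^ n = 0) :
    IsRightUniserial R ∧ IsArtinian Rᵐᵒᵖ R := by
  refine Submodule.total_and_isArtinian_of_chain (f := (π ^ ·)) (n := n)
    (fun i j hij => mem_span_singleton_right.2 (pow_dvd_pow π hij)) fun x => ?_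
  have hspan {a b : R} (hab : a ∣ b) (hba : b ∣ a) :
      Submodule.span Rᵐᵒᵖ {a} = Submodule.span Rᵐᵒᵖ {b} :=
    le_antisymm
      ((Submodule.span_singleton_le_iff_mem _ _).2 (mem_span_singleton_right.2 hba))
      ((Submodule.span_singleton_le_iff_mem _ _).2 (mem_span_singleton_right.2 hab))
  rcases hπ.pow_dvd_or_exists_unit x n with hx | ⟨i, hi, u, rfl⟩
  · exact ⟨n, le_rfl, hspan (by simp [hn]) hx⟩
  · exact ⟨i, hi.le, hspan ⟨↑u⁻¹, by simp⟩ ⟨u, rfl⟩⟩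

theorem ideal_total_and_isArtinian (hπ : IsRightUniformizer π) {n : ℕ} (hn : π ^ n = 0)
    (hleft : ∀ x, ∃ y, π * x = y * π) :
    (∀ I J : Ideal R, I ≤ J ∨ J ≤ I) ∧ IsArtinian R R := by
  have hpow (i : ℕ) (x : R) : ∃ y, π ^ i * x = y * π ^ i := by
    induction i generalizing x with
    | zero => exact ⟨x, by simp⟩
    | succ i ih =>
      obtain ⟨y, hy⟩ := hleft x
      obtain ⟨z, hz⟩ := ih y
      exact ⟨z, by rw [pow_succ, mul_assoc, hy, ← mul_assoc, hz, mul_assoc]⟩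
  refine Submodule.total_and_isArtinian_of_chain (f := (π ^ ·)) (n := n)
    (fun i j hij => Submodule.mem_span_singleton.2
      ⟨π ^ (j - i), by rw [smul_eq_mul, ← pow_add, Nat.sub_add_cancel hij]⟩) fun x => ?_
  have hspan {a b : R} (r s : R) (hab : b = r * a) (hba : a = s * b) :
      Submodule.span R {a} = Submodule.span R {b} :=
    le_antisymm
      ((Submodule.span_singleton_le_iff_mem _ _).2 (Submodule.mem_span_singleton.2 ⟨s, hba.symm⟩))
      ((Submodule.span_singleton_le_iff_mem _ _).2 (Submodule.mem_span_singleton.2 ⟨r, hab.symm⟩))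
  rcases hπ.pow_dvd_or_exists_unit x n with hx | ⟨i, hi, u, rfl⟩
  · rw [hn, zero_dvd_iff] at hx
    exact ⟨n, le_rfl, by simp [hx, hn]⟩
  · obtain ⟨y, hy⟩ := hpow i u
    obtain ⟨z, hz⟩ := hpow i ↑u⁻¹
    exact ⟨i, hi.le, hspan z y (by rw [← mul_assoc, ← hz, mul_assoc]; simp) hy⟩

theorem exists_mul_eq_mul_of_mem_center (hπ : IsRightUniformizer π)
    {n : ℕ} (hn : π ^ n = 0) {c : R}
    (hc : c ∈ Set.center R) (hc0 : c ≠ 0) (hcu : ¬ IsUnit c) (x : R) :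
    ∃ y, π * x = y * π := by
  obtain ⟨k, u, rfl⟩ : ∃ (k : ℕ) (u : Rˣ), c = π ^ k * u := by
    rcases hπ.pow_dvd_or_exists_unit c n with h | ⟨k, -, hk⟩
    · rw [hn, zero_dvd_iff] at h
      exact absurd h hc0
    · exact ⟨k, hk⟩
  obtain _ | k := k
  · simp at hcu
  have hk0 : π ^ (k + 1) ≠ 0 := fun h => hc0 (by rw [h, zero_mul])
  have hnormal (x : R) : ∃ y, π ^ (k + 1) * x = y * π ^ (k + 1) := by
    refine ⟨↑u⁻¹ * x * u, ?_⟩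
    have h1 : π ^ (k + 1) = (π ^ (k + 1) * u) * ↑u⁻¹ := by simp
    generalize π ^ (k + 1) * (u : R) = c at h1 hc
    rw [h1, mul_assoc, hc.comm, ← mul_assoc (↑u⁻¹ * x * (u : R)), mul_assoc _ c, hc.comm]
    simp [mul_assoc]
  have hmod (x : R) : ∃ y z, π * x = y * π + π ^ 2 * z := by
    obtain ⟨v, hv⟩ := hnormal x
    obtain ⟨y, hy⟩ := hπ.pow_dvd_mul_pow v k
    have h0 : π ^ k * (π * x - y * π) = 0 := by
      rw [mul_sub, ← mul_assoc, ← mul_assoc, ← hy, ← pow_succ, mul_assoc v, ← pow_succ, hv,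
        sub_self]
    obtain ⟨z, hz⟩ : π ^ 2 ∣ π * x - y * π := by
      refine (hπ.pow_dvd_or_exists_unit _ 2).resolve_right fun ⟨i, hi, w, hw⟩ => hk0 ?_
      rw [hw, ← mul_assoc, ← pow_add, Units.mul_left_eq_zero] at h0
      exact pow_eq_zero_of_le (by omega) h0
    exact ⟨y, z, by rw [← hz]; abel⟩
  have hiter (j : ℕ) : ∃ y z, π * x = y * π + π ^ (j + 1) * z := by
    induction j with
    | zero => exact ⟨0, x, by simp⟩
    | succ j ih =>
      obtain ⟨y, z, h⟩ := ih
      obtain ⟨y', z', h'⟩ := hmod z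
      refine ⟨y + π ^ j * y', z', ?_⟩
      rw [h, pow_succ, mul_assoc, h']
      noncomm_ring
  obtain ⟨y, z, h⟩ := hiter n
  exact ⟨y, by rw [h, pow_succ, hn]; simp⟩

theorem isCommDVR (hπ : IsRightUniformizer π)
    [Nontrivial R] [IsNoetherian Rᵐᵒᵖ R] (hCE : IsCentrallyEssential R)
    (hR : IsRightUniserial R) (hnil : ∀ n, π ^ n ≠ 0) : IsCommDVR R := by
  have hdom (x y : R) (hxy : x * y = 0) : x = 0 ∨ y = 0 := by
    by_contra! hne
    obtain ⟨i, u, rfl⟩ := hπ.exists_eq_pow_mul_unit hCE hne.1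
    have huy : (u : R) * y ≠ 0 := by simpa using hne.2
    obtain ⟨j, v, hv⟩ := hπ.exists_eq_pow_mul_unit hCE huy
    rw [mul_assoc, hv, ← mul_assoc, ← pow_add, Units.mul_left_eq_zero] at hxy
    exact hnil _ hxy
  have hcomm (x y : R) : x * y = y * x := by
    rcases eq_or_ne x 0 with rfl | hx
    · simp
    obtain ⟨c, d, hc, hd, hc0, -, hcd⟩ := hCE x hx
    refine sub_eq_zero.1 ((hdom (x * y - y * x) c ?_).resolve_right hc0)
    rw [sub_mul, mul_assoc, ← hc.comm, ← mul_assoc, hcd, mul_assoc, hcd, hd.comm, sub_self]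
  refine ⟨hcomm, hdom, hπ.isLocalRing, fun I => ?_, fun hF => ?_⟩
  · obtain ⟨a, ha⟩ := Submodule.exists_eq_span_singleton_of_total hR (idealOrderIsoRight hcomm I)
    refine ⟨a, Submodule.ext fun x => ?_⟩
    change x ∈ idealOrderIsoRight hcomm I ↔ _
    rw [ha, mem_span_singleton_right, Submodule.mem_span_singleton]
    exact ⟨fun ⟨r, hr⟩ => ⟨r, by rw [hr, hcomm, smul_eq_mul]⟩,
      fun ⟨r, hr⟩ => ⟨r, by rw [← hr, hcomm, smul_eq_mul]⟩⟩
  · obtain ⟨y, hy⟩ := hF.mul_inv_cancel (a := π) (by simpa using hnil 1)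
    exact hπ.not_isUnit_mul y (hy ▸ isUnit_one)

theorem isUniserialRing_and_isArtinianBothSides (hπ : IsRightUniformizer π)
    (hCE : IsCentrallyEssential R) {n : ℕ}
    (hn : π ^ n = 0) : IsUniserialRing R ∧ IsArtinianBothSides R := by
  have hleft (x : R) : ∃ y, π * x = y * π := by
    by_cases h : π * x = x * π
    · exact ⟨x, h⟩
    obtain ⟨c, d, hc, hd, hc0, -, hcd⟩ := hCE π (by rintro rfl; simp at h)
    refine hπ.exists_mul_eq_mul_of_mem_center hn hc hc0 (fun hcu => h ?_) x
    refine sub_eq_zero.1 (hcu.mul_left_eq_zero.1 ?_)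
    rw [sub_mul, mul_assoc, ← hc.comm, ← mul_assoc, hcd, mul_assoc, hcd, hd.comm, sub_self]
  have hr := hπ.isRightUniserial_and_isArtinian hn
  have hl := hπ.ideal_total_and_isArtinian hn hleft
  exact ⟨⟨hr.1, hl.1⟩, hl.2, hr.2⟩

end IsRightUniformizer

end Uniformizer

/-- A centrally essential ring `R` is a right uniserial, right Noetherian ring if and
only if `R` is either a commutative discrete valuation domain or a (not necessarily
commutative) uniserial Artinian ring. -/
theorem centrallyEssential_rightUniserial_rightNoetherian_iff {R : Type*} [Ring R]
    [Nontrivial R] (hCE : IsCentrallyEssential R) :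
    (IsRightUniserial R ∧ IsNoetherian Rᵐᵒᵖ R) ↔
      (IsCommDVR R ∨ (IsUniserialRing R ∧ IsArtinianBothSides R)) := by
  constructor
  · rintro ⟨hR, hN⟩
    obtain ⟨π, hπ⟩ := exists_isRightUniformizer hR
    by_cases hnil : ∃ n, π ^ n = 0
    · obtain ⟨n, hn⟩ := hnil
      exact .inr (hπ.isUniserialRing_and_isArtinianBothSides hCE hn)
    · exact .inl (hπ.isCommDVR hCE hR (not_exists.1 hnil))
  · rintro (h | ⟨hU, hA⟩)
    · exact h.isRightUniserial_and_isNoetherian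
    · exact ⟨hU.1, hA.2.isNoetherian_right⟩
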